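/- Let 1 < p < N and 0 < r < R. There exist η̂ = η̂(N,p,R) > 0 and c = c(N,p,R) > 0 such that, with g(r) := Cap_p(B_1) r^{N−p} + f_{η̂}(ω_N r^N), one has g(r) − g(1) ≥ c |r − 1| for all r ∈ (0, R], where f_η(s) = −(1/η)(s−ω_N) for s ≤ ω_N and f_η(s) = −η(s−ω_N) for s ≥ ω_N, and ω_N = |B_1|. -/

import Mathlib

open MeasureTheory

/-- The `p`-capacity of a set `Ω ⊆ ℝ^N`. -/
noncomputable def pCapacity (N : ℕ) (p : ℝ) (Ω : Set (EuclideanSpace ℝ (Fin N))) : ℝ :=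
  sInf { e : ℝ | ∃ u : EuclideanSpace ℝ (Fin N) → ℝ,
    ContDiff ℝ (⊤ : ℕ∞) u ∧ HasCompactSupport u ∧ (∀ x ∈ Ω, 1 ≤ u x) ∧
    e = ∫ x, ‖gradient u x‖ ^ p }

theorem norm_gradient {𝕜 F : Type*} [RCLike 𝕜] [NormedAddCommGroup F] [InnerProductSpace 𝕜 F]
    [CompleteSpace F] (u : F → 𝕜) (x : F) : ‖gradient u x‖ = ‖fderiv 𝕜 u x‖ :=
  (InnerProductSpace.toDual 𝕜 F).symm.norm_map _

/-- The `p`-Dirichlet energy of a test function for the capacity of `Ω` is bounded below by a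
positive constant, as a consequence of the Gagliardo–Nirenberg–Sobolev inequality. -/
theorem exists_pos_le_integral_norm_gradient_rpow {N : ℕ} {p : ℝ} (hp : 1 ≤ p) (hpN : p < N)
    {Ω : Set (EuclideanSpace ℝ (Fin N))} (hΩm : MeasurableSet Ω) (hΩ : volume Ω ≠ 0)
    (hΩ' : volume Ω ≠ ⊤) :
    ∃ δ : ℝ, 0 < δ ∧ ∀ u : EuclideanSpace ℝ (Fin N) → ℝ, ContDiff ℝ 1 u →
      HasCompactSupport u → (∀ x ∈ Ω, 1 ≤ u x) → δ ≤ ∫ x, ‖gradient u x‖ ^ p := by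
  have hp0 : 0 < p := by linarith
  have hN0 : (0 : ℝ) < N := by linarith
  have hq : 0 < p⁻¹ - (N : ℝ)⁻¹ := sub_pos.2 (inv_strictAnti₀ hp0 hpN)
  lift p to NNReal using hp0.le
  obtain ⟨q, hq'⟩ : ∃ q : NNReal, (q : ℝ)⁻¹ = (p : ℝ)⁻¹ - (N : ℝ)⁻¹ :=
    ⟨((p : ℝ)⁻¹ - (N : ℝ)⁻¹)⁻¹.toNNReal, by
      rw [Real.coe_toNNReal _ (by positivity), inv_inv]⟩
  have hq0 : (q : ENNReal) ≠ 0 := by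
    intro h
    rw [ENNReal.coe_eq_zero] at h
    simp [h] at hq'
    linarith
  set S := SNormLESNormFDerivOfEqConst ℝ
    (volume : Measure (EuclideanSpace ℝ (Fin N))) p
  set v : ℝ := (volume Ω ^ (1 / (q : ℝ))).toReal
  have hv0 : 0 < v :=
    ENNReal.toReal_pos (by simp [hΩ, hΩ']) (ENNReal.rpow_ne_top_of_nonneg (by positivity) hΩ')
  refine ⟨(v / (S + 1)) ^ (p : ℝ), by positivity, fun u hu hcu hΩu => ?_⟩
  set I := ∫ x, ‖gradient u x‖ ^ (p : ℝ) with hI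
  have hI0 : 0 ≤ I := integral_nonneg fun x => by positivity
  have hsob : eLpNorm u q volume ≤ S * eLpNorm (fderiv ℝ u) p volume :=
    eLpNorm_le_eLpNorm_fderiv_of_eq volume hu hcu (by exact_mod_cast hp)
      (by simpa using hN0) (by simpa using hq')
  have hlow : volume Ω ^ (1 / (q : ℝ)) ≤ eLpNorm u q volume := by
    calc volume Ω ^ (1 / (q : ℝ)) = eLpNorm (Ω.indicator fun _ => (1 : ℝ)) q volume := by
          rw [eLpNorm_indicator_const hΩm hq0 ENNReal.coe_ne_top]
          simp
      _ ≤ eLpNorm u q volume := by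
          refine eLpNorm_mono fun x => ?_
          by_cases hx : x ∈ Ω
          · simpa [hx] using (hΩu x hx).trans (le_abs_self _)
          · simp [hx]
  have hmem : MemLp (fderiv ℝ u) p volume :=
    (hu.continuous_fderiv one_ne_zero).memLp_of_hasCompactSupport (hcu.fderiv ℝ)
  have hgrad : eLpNorm (fderiv ℝ u) p volume = ENNReal.ofReal (I ^ (p : ℝ)⁻¹) := by
    rw [hmem.eLpNorm_eq_integral_rpow_norm (by simpa using hp0.ne') ENNReal.coe_ne_top]
    simp [hI, norm_gradient]
  have hvI : v ≤ S * I ^ (p : ℝ)⁻¹ := by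
    rw [hgrad] at hsob
    have h := ENNReal.toReal_mono (by finiteness) (hlow.trans hsob)
    rwa [ENNReal.toReal_mul, ENNReal.toReal_ofReal (by positivity), ENNReal.coe_toReal] at h
  have hIp : 0 ≤ I ^ (p : ℝ)⁻¹ := by positivity
  calc (v / (S + 1)) ^ (p : ℝ) ≤ (I ^ (p : ℝ)⁻¹) ^ (p : ℝ) := by
        gcongr
        rw [div_le_iff₀ (by positivity)]
        linarith
    _ = I := Real.rpow_inv_rpow hI0 hp0.ne'

theorem pCapacity_pos {N : ℕ} {p : ℝ} (hp : 1 ≤ p) (hpN : p < N)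
    {Ω : Set (EuclideanSpace ℝ (Fin N))} (hΩm : MeasurableSet Ω) (hΩ : volume Ω ≠ 0)
    (hΩb : Bornology.IsBounded Ω) : 0 < pCapacity N p Ω := by
  obtain ⟨δ, hδ, h⟩ :=
    exists_pos_le_integral_norm_gradient_rpow hp hpN hΩm hΩ hΩb.measure_lt_top.ne
  refine hδ.trans_le (le_csInf ?_ ?_)
  · obtain ⟨ρ, hρ, hΩρ⟩ := hΩb.subset_closedBall_lt 0 0
    let φ : ContDiffBump (0 : EuclideanSpace ℝ (Fin N)) := ⟨ρ, ρ + 1, hρ, by linarith⟩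
    exact ⟨_, φ, φ.contDiff, φ.hasCompactSupport,
      fun x hx => (φ.one_of_mem_closedBall (hΩρ hx)).ge, rfl⟩
  · rintro _ ⟨u, hu, hcu, hΩu, rfl⟩
    exact h u (hu.of_le (by exact_mod_cast le_top)) hcu hΩu

theorem mul_sub_one_div_le_rpow_sub_one {a r R : ℝ} (ha : 0 ≤ a) (hr : 1 ≤ r) (hrR : r ≤ R) :
    a * (r - 1) / R ≤ r ^ a - 1 := by
  have hr0 : 0 < r := by linarith
  calc a * (r - 1) / R ≤ a * (r - 1) / r := by
        have := sub_nonneg.2 hr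
        gcongr
    _ = (1 - r⁻¹) * a := by field_simp
    _ ≤ Real.log r * a := by
        gcongr
        exact Real.one_sub_inv_le_log_of_pos hr0
    _ ≤ r ^ a - 1 := by
        rw [Real.rpow_def_of_pos hr0]
        linarith [Real.add_one_le_exp (Real.log r * a)]

theorem pow_sub_one_le_geom_sum_mul {r R : ℝ} (N : ℕ) (hr : 1 ≤ r) (hrR : r ≤ R) :
    r ^ N - 1 ≤ (∑ i ∈ Finset.range N, R ^ i) * (r - 1) := by
  rw [← geom_sum_mul]
  have := sub_nonneg.2 hr
  gcongr

/-- For `1 < p < N` and `R > 0` there are `η̂ > 0` and `c > 0` such that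
`g(r) := Cap_p(B_1) r^(N−p) + f_{η̂}(ω_N r^N)` satisfies `g(r) − g(1) ≥ c |r − 1|` for all
`r ∈ (0, R]`, where `f_η` is the standard volume penalization and `ω_N = |B_1|`. -/
theorem stmt_11 (N : ℕ) (hN : 2 ≤ N) (p : ℝ) (hp : 1 < p) (hpN : p < N) (R : ℝ) (hR : 0 < R) :
    ∃ ηh c : ℝ, 0 < ηh ∧ 0 < c ∧
      (let ωN : ℝ := (volume (Metric.ball (0 : EuclideanSpace ℝ (Fin N)) 1)).toReal
       let fη : ℝ → ℝ := fun s => if s ≤ ωN then -(1 / ηh) * (s - ωN) else -ηh * (s - ωN)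
       let g : ℝ → ℝ := fun r =>
         pCapacity N p (Metric.ball 0 1) * r ^ ((N : ℝ) - p) + fη (ωN * r ^ (N : ℕ))
       ∀ r : ℝ, r ∈ Set.Ioc (0 : ℝ) R → g r - g 1 ≥ c * |r - 1|) := by
  have hNp : 0 < (N : ℝ) - p := sub_pos.2 hpN
  have hωpos : 0 < volume (Metric.ball (0 : EuclideanSpace ℝ (Fin N)) 1) :=
    Metric.measure_ball_pos _ _ one_pos
  have hK := pCapacity_pos hp.le hpN measurableSet_ball hωpos.ne' Metric.isBounded_ball
  have hω := ENNReal.toReal_pos hωpos.ne' measure_ball_lt_top.ne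
  set K := pCapacity N p (Metric.ball 0 1)
  set ω := (volume (Metric.ball (0 : EuclideanSpace ℝ (Fin N)) 1)).toReal
  set a := (N : ℝ) - p
  set M := ∑ i ∈ Finset.range N, R ^ i
  have hM0 : 0 < M :=
    Finset.sum_pos (fun i _ => by positivity) (Finset.nonempty_range_iff.2 (by omega))
  set η := min (ω / (K + 1)) (K * a / (2 * R) / (ω * M))
  have hη0 : 0 < η := lt_min (by positivity) (by positivity)
  have hη1 : K + 1 ≤ 1 / η * ω := by
    have h : η ≤ ω / (K + 1) := min_le_left _ _
    rw [le_div_iff₀ (by positivity)] at h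
    rw [one_div_mul_eq_div, le_div_iff₀ hη0]
    linarith
  have hη2 : η * (ω * M) ≤ K * a / (2 * R) := by
    rw [← le_div_iff₀ (by positivity)]
    exact min_le_right _ _
  refine ⟨η, min 1 (K * a / (2 * R)), hη0, lt_min one_pos (by positivity), ?_⟩
  rintro ωN fη g r ⟨hr0, hrR⟩
  have hg1 : g 1 = K := by simp [g, fη]
  rw [hg1, ge_iff_le]
  rcases le_or_gt r 1 with hr | hr
  · have hrN : r ^ N ≤ 1 := pow_le_one₀ hr0.le hr
    have hrN' : r ^ N ≤ r := pow_le_of_le_one hr0.le hr (by omega)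
    have hra : r ^ N ≤ r ^ a := by
      rw [← Real.rpow_natCast]
      exact Real.rpow_le_rpow_of_exponent_ge hr0 hr (by linarith)
    have hg : g r = K * r ^ a + -(1 / η) * (ω * r ^ N - ω) :=
      congrArg (K * r ^ a + ·) (if_pos (mul_le_of_le_one_right hω.le hrN))
    rw [hg, abs_of_nonpos (by linarith)]
    calc min 1 (K * a / (2 * R)) * -(r - 1) ≤ 1 * -(r - 1) := by
          have : 0 ≤ -(r - 1) := by linarith
          gcongr
          exact min_le_left _ _
      _ ≤ 1 - r ^ N := by linarith
      _ ≤ (1 / η * ω) * (1 - r ^ N) - K * (1 - r ^ N) := by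
          nlinarith [mul_le_mul_of_nonneg_right hη1 (sub_nonneg.2 hrN)]
      _ ≤ (1 / η * ω) * (1 - r ^ N) - K * (1 - r ^ a) := by gcongr
      _ = K * r ^ a + -(1 / η) * (ω * r ^ N - ω) - K := by ring
  · have hrN : 1 < r ^ N := one_lt_pow₀ hr (by omega)
    have hg : g r = K * r ^ a + -η * (ω * r ^ N - ω) :=
      congrArg (K * r ^ a + ·) (if_neg (lt_mul_of_one_lt_right hω hrN).not_ge)
    rw [hg, abs_of_pos (by linarith)]
    have hr1 : 0 ≤ r - 1 := by linarith
    calc min 1 (K * a / (2 * R)) * (r - 1) ≤ K * a / (2 * R) * (r - 1) := by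
          gcongr
          exact min_le_right _ _
      _ = K * (a * (r - 1) / R) - K * a / (2 * R) * (r - 1) := by
          field_simp
          ring
      _ ≤ K * (r ^ a - 1) - η * (ω * M) * (r - 1) := by
          gcongr
          exact mul_sub_one_div_le_rpow_sub_one hNp.le hr.le hrR
      _ = K * (r ^ a - 1) - η * ω * (M * (r - 1)) := by ring
      _ ≤ K * (r ^ a - 1) - η * ω * (r ^ N - 1) := by
          gcongr
          exact pow_sub_one_le_geom_sum_mul N hr.le hrR
      _ = K * r ^ a + -η * (ω * r ^ N - ω) - K := by ring
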